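/- arXiv:1212.3776 — 2 statements merged into one kernel-verified Lean document; each statement's English description precedes it below -/
import Mathlib

section
/- Let E be a closed ordered space (a topological space with a partial order whose graph is closed) whose topology is second countable and locally compact, and suppose E is k-preserving or compactly generated. Then E is quasi-pseudo-metrizable: there exists a quasi-pseudo-metric p : E × E → [0,∞) such that the topology of E is the topology induced by the pseudo-metric (x,y) ↦ max(p(x,y), p(y,x)) and x ≤ y ⇔ p(x,y) = 0; moreover p is an Albert quasi-metric, i.e., p(x,y) = p(y,x) = 0 implies x = y. -/
open Topology

/-- The increasing hull `i(S) = {y | ∃ x ∈ S, x ≤ y}`. -/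
def incHull {E : Type*} [Preorder E] (S : Set E) : Set E := {y | ∃ x ∈ S, x ≤ y}

/-- The decreasing hull `d(S) = {y | ∃ x ∈ S, y ≤ x}`. -/
def decHull {E : Type*} [Preorder E] (S : Set E) : Set E := {y | ∃ x ∈ S, y ≤ x}

/-- The image `R(K) = {y | ∃ x ∈ K, (x,y) ∈ R}` of a set under a relation. -/
def relImage {E : Type*} (R : Set (E × E)) (K : Set E) : Set E :=
  {y | ∃ x ∈ K, (x, y) ∈ R}


namespace QPM

open Set

lemma closed_image {X Y : Type*} [TopologicalSpace X] [TopologicalSpace Y] {G : Set (X × Y)}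
    (hG : IsClosed G) {K : Set X} (hK : IsCompact K) : IsClosed {y | ∃ x ∈ K, (x, y) ∈ G} := by
  rw [← isOpen_compl_iff, isOpen_iff_forall_mem_open]
  intro y hy
  obtain ⟨u, v, _, hv, hKu, hyv, huv⟩ := generalized_tube_lemma hK (isCompact_singleton (x := y))
    hG.isOpen_compl (by
      rintro ⟨a, b⟩ ⟨ha, hb⟩ hab
      rw [mem_singleton_iff] at hb
      simp only at ha hb
      subst hb
      exact hy ⟨a, ha, hab⟩)
  refine ⟨v, ?_, hv, hyv rfl⟩
  rintro b hb ⟨a, ha, hab⟩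
  exact huv (mk_mem_prod (hKu ha) hb) hab

lemma enlarge {E : Type*} [TopologicalSpace E] [T2Space E] [NormalSpace E] (r : E → E → Prop)
    (hr : IsClosed {p : E × E | r p.1 p.2}) (hrefl : ∀ a, r a a)
    (htr : ∀ a b c, r a b → r b c → r a c) {K A O : Set E} (hK : IsCompact K)
    (hA : IsClosed A) (hinc : ∀ y ∈ A, ∀ z ∈ K, r y z → z ∈ A)
    (hO : IsOpen O) (hAO : A ⊆ O) :
    ∃ A' G : Set E, IsClosed A' ∧ A' ⊆ K ∧ (∀ y ∈ A', ∀ z ∈ K, r y z → z ∈ A') ∧ A' ⊆ O ∧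
      IsOpen G ∧ A ⊆ G ∧ G ∩ K ⊆ A' := by
  have hr' : IsClosed {p : E × E | r p.2 p.1} := hr.preimage continuous_swap
  have hW : IsClosed {y | ∃ x ∈ K \ O, (x, y) ∈ {p : E × E | r p.2 p.1}} :=
    closed_image hr' (hK.diff hO)
  obtain ⟨G, hG, hAG, hGW⟩ := normal_exists_closure_subset hA hW.isOpen_compl (by
    rintro y hy ⟨z, ⟨hzK, hzO⟩, hyz⟩
    exact hzO (hAO (hinc y hy z hzK hyz)))
  refine ⟨{y | ∃ x ∈ K ∩ closure G, (x, y) ∈ {p : E × E | r p.1 p.2}} ∩ K, G,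
    (closed_image hr (hK.inter_right isClosed_closure)).inter hK.isClosed, inter_subset_right,
    ?_, ?_, hG, hAG, ?_⟩
  · rintro y ⟨⟨x, hx, hxy⟩, _⟩ z hz hyz
    exact ⟨⟨x, hx, htr _ _ _ hxy hyz⟩, hz⟩
  · rintro y ⟨⟨x, hx, hxy⟩, hyK⟩
    by_contra hyO
    exact hGW hx.2 ⟨y, ⟨hyK, hyO⟩, hxy⟩
  · rintro y ⟨hyG, hyK⟩
    exact ⟨⟨y, ⟨hyK, subset_closure hyG⟩, hrefl y⟩, hyK⟩

section
variable {E : Type*} [TopologicalSpace E] [Preorder E]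

structure Inv (K A B U : Set E) (q : Set E × Set E) : Prop where
  c1 : IsClosed q.1
  c2 : IsClosed q.2
  s1 : q.1 ⊆ K
  s2 : q.2 ⊆ K
  i1 : ∀ y ∈ q.1, ∀ z ∈ K, y ≤ z → z ∈ q.1
  i2 : ∀ y ∈ q.2, ∀ z ∈ K, z ≤ y → z ∈ q.2
  a1 : A ∩ K ⊆ q.1
  a2 : B ∩ K ⊆ q.2
  u : q.1 ∩ q.2 ⊆ U

def Nb (K : Set E) (s s' : Set E) : Prop := ∃ G : Set E, IsOpen G ∧ s ⊆ G ∧ G ∩ K ⊆ s'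

lemma sep [T2Space E] [NormalSpace E] (hG : IsClosed {p : E × E | p.1 ≤ p.2})
    (K : ℕ → Set E) (hK : ∀ n, IsCompact (K n)) (hKi : ∀ n, K n ⊆ interior (K (n+1)))
    (hKu : ∀ x, ∃ n, x ∈ K n) {A B U : Set E} (hA : IsClosed A) (hB : IsClosed B)
    (hAi : ∀ y ∈ A, ∀ z, y ≤ z → z ∈ A) (hBi : ∀ y ∈ B, ∀ z, z ≤ y → z ∈ B)
    (hU : IsOpen U) (hAB : A ∩ B ⊆ U)
    (hc : U = ∅ ∨ ((∀ z ∈ U, ∀ w ∈ U, ∀ y, z ≤ y → y ≤ w → y ∈ K 0) ∧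
      (∀ y ∈ A, ∃ x ∈ A ∩ K 0, x ≤ y) ∧ (∀ y ∈ B, ∃ x ∈ B ∩ K 0, y ≤ x))) :
    ∃ P Q : Set E, IsOpen P ∧ IsOpen Q ∧ (∀ y ∈ P, ∀ z, y ≤ z → z ∈ P) ∧
      (∀ y ∈ Q, ∀ z, z ≤ y → z ∈ Q) ∧ A ⊆ P ∧ B ⊆ Q ∧ P ∩ Q ⊆ U := by
  have hmono : Monotone K := monotone_nat_of_le_succ fun n => (hKi n).trans interior_subset
  have hG' : IsClosed {p : E × E | p.2 ≤ p.1} := hG.preimage continuous_swap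
  have step : ∀ n q, Inv (K n) A B U q → ∃ q', Inv (K (n+1)) A B U q' ∧
      Nb (K (n+1)) q.1 q'.1 ∧ Nb (K (n+1)) q.2 q'.2 := by
    intro n q hq
    set A' := (A ∪ {y | ∃ x ∈ q.1, (x, y) ∈ {p : E × E | p.1 ≤ p.2}}) ∩ K (n+1) with hA'
    set B' := (B ∪ {y | ∃ x ∈ q.2, (x, y) ∈ {p : E × E | p.2 ≤ p.1}}) ∩ K (n+1) with hB'
    have k1 : IsCompact q.1 := (hK n).of_isClosed_subset hq.c1 hq.s1
    have k2 : IsCompact q.2 := (hK n).of_isClosed_subset hq.c2 hq.s2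
    have cA : IsClosed A' := (hA.union (closed_image hG k1)).inter (hK _).isClosed
    have cB : IsClosed B' := (hB.union (closed_image hG' k2)).inter (hK _).isClosed
    have key : ∀ z ∈ q.1, ∀ w ∈ q.2, ∀ y, z ≤ y → y ≤ w → y ∈ U := by
      intro z hz w hw y hzy hyw
      have hwU : w ∈ U := hq.u ⟨hq.i1 z hz w (hq.s2 hw) (hzy.trans hyw), hw⟩
      have hzU : z ∈ U := hq.u ⟨hz, hq.i2 w hw z (hq.s1 hz) (hzy.trans hyw)⟩
      rcases hc with h | ⟨h, _, _⟩
      · rw [h] at hwU; exact hwU.elim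
      · have hy : y ∈ K n := hmono (Nat.zero_le n) (h z hzU w hwU y hzy hyw)
        exact hq.u ⟨hq.i1 z hz y hy hzy, hq.i2 w hw y hy hyw⟩
    have hAB' : A' ∩ B' ⊆ U := by
      rintro y ⟨⟨h1, _⟩, ⟨h2, _⟩⟩
      rcases h1 with h1 | ⟨z, hz, hzy⟩ <;> rcases h2 with h2 | ⟨w, hw, hyw⟩
      · exact hAB ⟨h1, h2⟩
      · rcases hc with h | ⟨_, h, _⟩
        · have : w ∈ U := hq.u ⟨hq.a1 ⟨hAi y h1 w hyw, hq.s2 hw⟩, hw⟩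
          rw [h] at this; exact this.elim
        · obtain ⟨x, hx, hxy⟩ := h y h1
          exact key x (hq.a1 ⟨hx.1, hmono (Nat.zero_le n) hx.2⟩) w hw y hxy hyw
      · rcases hc with h | ⟨_, _, h⟩
        · have : z ∈ U := hq.u ⟨hz, hq.a2 ⟨hBi y h2 z hzy, hq.s1 hz⟩⟩
          rw [h] at this; exact this.elim
        · obtain ⟨x, hx, hxy⟩ := h y h2
          exact key z hz x (hq.a2 ⟨hx.1, hmono (Nat.zero_le n) hx.2⟩) y hzy hxy
      · exact key z hz w hw y hzy hyw
    obtain ⟨G1, G2, o1, o2, g1, g2, hd⟩ := normal_separation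
      (cA.inter hU.isClosed_compl) (cB.inter hU.isClosed_compl)
      (by
        rw [Set.disjoint_left]
        rintro y ⟨h1, h1'⟩ ⟨h2, _⟩
        exact h1' (hAB' ⟨h1, h2⟩))
    obtain ⟨A2, GA, e1, e2, e3, e4, e5, e6, e7⟩ := enlarge (fun a b : E => a ≤ b) hG
      (fun a => le_refl a) (fun a b c => le_trans) (hK (n+1)) cA
      (by
        rintro y ⟨h | ⟨x, hx, hxy⟩, _⟩ z hz hyz
        · exact ⟨Or.inl (hAi y h z hyz), hz⟩
        · exact ⟨Or.inr ⟨x, hx, le_trans (show x ≤ y from hxy) hyz⟩, hz⟩)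
      (o1.union hU)
      (by
        intro y hy
        by_cases h : y ∈ U
        · exact Or.inr h
        · exact Or.inl (g1 ⟨hy, h⟩))
    obtain ⟨B2, GB, f1, f2, f3, f4, f5, f6, f7⟩ := enlarge (fun a b : E => b ≤ a) hG'
      (fun a => le_refl a) (fun a b c h h' => le_trans h' h) (hK (n+1)) cB
      (by
        rintro y ⟨h | ⟨x, hx, hxy⟩, _⟩ z hz hyz
        · exact ⟨Or.inl (hBi y h z hyz), hz⟩
        · exact ⟨Or.inr ⟨x, hx, le_trans hyz (show y ≤ x from hxy)⟩, hz⟩)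
      (o2.union hU)
      (by
        intro y hy
        by_cases h : y ∈ U
        · exact Or.inr h
        · exact Or.inl (g2 ⟨hy, h⟩))
    have hKK : K n ⊆ K (n+1) := hmono (Nat.le_succ n)
    refine ⟨(A2, B2), ⟨e1, f1, e2, f2, e3, f3, ?_, ?_, ?_⟩, ⟨GA, e5, ?_, e7⟩, ⟨GB, f5, ?_, f7⟩⟩
    · rintro y ⟨h, h'⟩
      exact e7 ⟨e6 ⟨Or.inl h, h'⟩, h'⟩
    · rintro y ⟨h, h'⟩
      exact f7 ⟨f6 ⟨Or.inl h, h'⟩, h'⟩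
    · rintro y ⟨h, h'⟩
      rcases e4 h with h1 | h1
      · rcases f4 h' with h2 | h2
        · exact (Set.disjoint_left.1 hd h1 h2).elim
        · exact h2
      · exact h1
    · intro y hy
      exact e6 ⟨Or.inr ⟨y, hy, le_refl y⟩, hKK (hq.s1 hy)⟩
    · intro y hy
      exact f6 ⟨Or.inr ⟨y, hy, le_refl y⟩, hKK (hq.s2 hy)⟩
  choose! F hF1 hF2 hF3 using step
  let S : ℕ → Set E × Set E := fun n => Nat.rec (A ∩ K 0, B ∩ K 0) (fun n q => F n q) n
  have hS : ∀ n, Inv (K n) A B U (S n) := by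
    intro n
    induction n with
    | zero =>
      exact ⟨hA.inter (hK 0).isClosed, hB.inter (hK 0).isClosed, inter_subset_right,
        inter_subset_right, fun y hy z hz h => ⟨hAi y hy.1 z h, hz⟩,
        fun y hy z hz h => ⟨hBi y hy.1 z h, hz⟩, subset_rfl, subset_rfl,
        fun y hy => hAB ⟨hy.1.1, hy.2.1⟩⟩
    | succ n ih => exact hF1 n _ ih
  have hN1 : ∀ n, Nb (K (n+1)) (S n).1 (S (n+1)).1 := fun n => hF2 n _ (hS n)
  have hN2 : ∀ n, Nb (K (n+1)) (S n).2 (S (n+1)).2 := fun n => hF3 n _ (hS n)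
  have gen : ∀ T : ℕ → Set E, (∀ n, T n ⊆ K n) → (∀ n, Nb (K (n+1)) (T n) (T (n+1))) →
      Monotone T ∧ IsOpen (⋃ n, T n) := by
    intro T hT hN
    constructor
    · refine monotone_nat_of_le_succ fun n y hy => ?_
      obtain ⟨G, _, h2, h3⟩ := hN n
      exact h3 ⟨h2 hy, hmono (Nat.le_succ n) (hT n hy)⟩
    · rw [isOpen_iff_mem_nhds]
      intro y hy
      obtain ⟨n, hn⟩ := mem_iUnion.1 hy
      obtain ⟨G, h1, h2, h3⟩ := hN n
      refine Filter.mem_of_superset (Filter.inter_mem (h1.mem_nhds (h2 hn))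
        (mem_interior_iff_mem_nhds.1 (hKi n (hT n hn)))) ?_
      exact h3.trans (subset_iUnion T (n+1))
  obtain ⟨m1, op1⟩ := gen (fun n => (S n).1) (fun n => (hS n).s1) hN1
  obtain ⟨m2, op2⟩ := gen (fun n => (S n).2) (fun n => (hS n).s2) hN2
  refine ⟨_, _, op1, op2, ?_, ?_, ?_, ?_, ?_⟩
  · intro y hy z hyz
    obtain ⟨n, hn⟩ := mem_iUnion.1 hy
    obtain ⟨k, hk⟩ := hKu z
    exact mem_iUnion.2 ⟨max n k, (hS _).i1 y (m1 (le_max_left n k) hn) z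
      (hmono (le_max_right n k) hk) hyz⟩
  · intro y hy z hyz
    obtain ⟨n, hn⟩ := mem_iUnion.1 hy
    obtain ⟨k, hk⟩ := hKu z
    exact mem_iUnion.2 ⟨max n k, (hS _).i2 y (m2 (le_max_left n k) hn) z
      (hmono (le_max_right n k) hk) hyz⟩
  · intro y hy
    obtain ⟨k, hk⟩ := hKu y
    exact mem_iUnion.2 ⟨k, (hS k).a1 ⟨hy, hk⟩⟩
  · intro y hy
    obtain ⟨k, hk⟩ := hKu y
    exact mem_iUnion.2 ⟨k, (hS k).a2 ⟨hy, hk⟩⟩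
  · rintro y ⟨h1, h2⟩
    obtain ⟨n, hn⟩ := mem_iUnion.1 h1
    obtain ⟨k, hk⟩ := mem_iUnion.1 h2
    exact (hS (max n k)).u ⟨m1 (le_max_left n k) hn, m2 (le_max_right n k) hk⟩


def Phi (E : Type*) [TopologicalSpace E] [Preorder E] : Set (E → ℝ) :=
  {f | Continuous f ∧ Monotone f ∧ ∀ x, 0 ≤ f x ∧ f x ≤ 1}

lemma approx_anti {P : Set E → Set E → Prop} (hP : ∀ c u, P c u → ∀ y ∈ u, ∀ z, y ≤ z → z ∈ u)
    (n : ℕ) (c : Urysohns.CU P) : Antitone (c.approx n) := by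
  induction n generalizing c with
  | zero =>
    intro y z hyz
    by_cases h : y ∈ c.U
    · have hz : z ∈ c.U := hP _ _ c.P_C_U y h z hyz
      simp [Urysohns.CU.approx, h, hz]
    · rw [c.approx_of_notMem_U 0 h]
      exact c.approx_le_one 0 z
  | succ n ih =>
    intro y z hyz
    simp only [Urysohns.CU.approx]
    exact midpoint_le_midpoint (ih _ hyz) (ih _ hyz)

lemma urysohn (hN : ∀ A B : Set E, IsClosed A → IsClosed B → (∀ y ∈ A, ∀ z, y ≤ z → z ∈ A) →
      (∀ y ∈ B, ∀ z, z ≤ y → z ∈ B) → A ∩ B ⊆ ∅ →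
      ∃ P Q : Set E, IsOpen P ∧ IsOpen Q ∧ (∀ y ∈ P, ∀ z, y ≤ z → z ∈ P) ∧
      (∀ y ∈ Q, ∀ z, z ≤ y → z ∈ Q) ∧ A ⊆ P ∧ B ⊆ Q ∧ P ∩ Q ⊆ ∅)
    {c u : Set E} (hc : IsClosed c) (hu : IsOpen u) (hci : ∀ y ∈ c, ∀ z, y ≤ z → z ∈ c)
    (hui : ∀ y ∈ u, ∀ z, y ≤ z → z ∈ u) (hcu : c ⊆ u) :
    ∃ f ∈ Phi E, (∀ x ∈ c, f x = 1) ∧ ∀ x, x ∉ u → f x = 0 := by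
  let P : Set E → Set E → Prop := fun c u => (∀ y ∈ u, ∀ z, y ≤ z → z ∈ u) ∧
    ∃ c', IsClosed c' ∧ (∀ y ∈ c', ∀ z, y ≤ z → z ∈ c') ∧ c ⊆ c' ∧ c' ⊆ u
  let C : Urysohns.CU P :=
    { C := c
      U := u
      P_C_U := ⟨hui, c, hc, hci, subset_rfl, hcu⟩
      closed_C := hc
      open_U := hu
      subset := hcu
      hP := by
        rintro c u hc ⟨hui, c', hc', hci', hcc', hcu'⟩ hu hcu
        obtain ⟨V, Q, hV, hQ, hVi, hQi, h1, h2, h3⟩ := hN c' uᶜ hc' hu.isClosed_compl hci'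
          (fun y hy z hzy hz => hy (hui z hz y hzy)) (fun y hy => hy.2 (hcu' hy.1))
        have hVQ : closure V ⊆ Qᶜ :=
          closure_minimal (fun y hy hyQ => h3 ⟨hy, hyQ⟩) hQ.isClosed_compl
        have hQu : Qᶜ ⊆ u := compl_subset_comm.1 h2
        exact ⟨V, hV, hcc'.trans h1, hVQ.trans hQu, ⟨hVi, c', hc', hci', hcc', h1⟩,
          hui, Qᶜ, hQ.isClosed_compl, fun y hy z hyz hz => hy (hQi z hz y hyz), hVQ, hQu⟩ }
  refine ⟨fun x => 1 - C.lim x, ⟨continuous_const.sub C.continuous_lim, ?_, ?_⟩, ?_, ?_⟩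
  · intro y z hyz
    have : C.lim z ≤ C.lim y :=
      ciSup_le fun n => (approx_anti (fun c u h => h.1) n C hyz).trans (C.approx_le_lim y n)
    simp only
    linarith
  · intro x
    have := C.lim_nonneg x
    have := C.lim_le_one x
    constructor <;> simp only <;> linarith
  · intro x hx
    simp [C.lim_of_mem_C x hx]
  · intro x hx
    simp [C.lim_of_notMem_U x hx]

lemma hull_of_gen [T2Space E] [LocallyCompactSpace E] (hG : IsClosed {p : E × E | p.1 ≤ p.2})
    (hanti : ∀ a b : E, a ≤ b → b ≤ a → a = b) (R : Set (E × E))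
    (hR : R ⊆ {p : E × E | p.1 ≤ p.2})
    (hRc : ∀ K : Set E, IsCompact K → IsCompact (closure (relImage R K)))
    (hRm : ∀ T : Set (E × E), IsClosed T → (∀ a : E, (a, a) ∈ T) →
          (∀ a b c : E, (a, b) ∈ T → (b, c) ∈ T → (a, c) ∈ T) → R ⊆ T →
          {p : E × E | p.1 ≤ p.2} ⊆ T) (x : E) :
    ∃ U N : Set E, IsOpen U ∧ x ∈ U ∧ IsCompact N ∧
      ∀ z ∈ U, ∀ w ∈ U, ∀ y, z ≤ y → y ≤ w → y ∈ N := by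
  obtain ⟨N, hN, hxN⟩ := exists_compact_mem_nhds x
  set D := (N ∪ closure (relImage R N)) \ interior N with hD
  have hDc : IsCompact D := (hN.union (hRc N hN)).diff isOpen_interior
  set M : Set (E × E) := {q | ∃ c ∈ D, (c, q) ∈ {t : E × (E × E) | t.2.1 ≤ t.1 ∧ t.1 ≤ t.2.2}}
    with hM
  have hMc : IsClosed M := by
    refine closed_image ?_ hDc
    have h1 : IsClosed {t : E × (E × E) | t.2.1 ≤ t.1} :=
      hG.preimage (f := fun t : E × (E × E) => (t.2.1, t.1)) (by fun_prop)
    have h2 : IsClosed {t : E × (E × E) | t.1 ≤ t.2.2} :=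
      hG.preimage (f := fun t : E × (E × E) => (t.1, t.2.2)) (by fun_prop)
    exact h1.inter h2
  have hT := hRm ({q : E × E | q.1 ≤ q.2} ∩
      ((Prod.fst ⁻¹' (interior N)ᶜ) ∪ (Prod.snd ⁻¹' N) ∪ M))
    (hG.inter (((isOpen_interior.isClosed_compl.preimage continuous_fst).union
      (hN.isClosed.preimage continuous_snd)).union hMc))
    (by
      intro a
      refine ⟨le_refl a, Or.inl ?_⟩
      by_cases h : a ∈ interior N
      · exact Or.inr (show a ∈ N from interior_subset h)
      · exact Or.inl h)
    (by
      rintro a b c ⟨hab, h1⟩ ⟨hbc, h2⟩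
      replace hab : a ≤ b := hab
      replace hbc : b ≤ c := hbc
      refine ⟨hab.trans hbc, ?_⟩
      by_cases ha : a ∈ interior N
      swap
      · exact Or.inl (Or.inl ha)
      by_cases hc : c ∈ N
      · exact Or.inl (Or.inr hc)
      right
      by_cases hb : b ∈ interior N
      · rcases h2 with (h2 | h2) | ⟨d, hd, h3, h4⟩
        · exact (h2 hb).elim
        · exact (hc h2).elim
        · exact ⟨d, hd, hab.trans h3, h4⟩
      · by_cases hbN : b ∈ N
        · exact ⟨b, ⟨Or.inl hbN, hb⟩, hab, hbc⟩
        · rcases h1 with (h2 | h2) | ⟨d, hd, h3, h4⟩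
          · exact (h2 ha).elim
          · exact (hbN h2).elim
          · exact ⟨d, hd, h3, le_trans h4 hbc⟩)
    (by
      rintro ⟨a, b⟩ hab
      refine ⟨hR hab, ?_⟩
      by_cases ha : a ∈ interior N
      swap
      · exact Or.inl (Or.inl ha)
      by_cases hb : b ∈ N
      · exact Or.inl (Or.inr hb)
      · exact Or.inr ⟨b, ⟨Or.inr (subset_closure ⟨a, interior_subset ha, hab⟩),
          fun h => hb (interior_subset h)⟩, hR hab, le_refl b⟩)
  have hxi : x ∈ interior N := mem_interior_iff_mem_nhds.2 hxN
  have hxM : (x, x) ∈ Mᶜ := by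
    rintro ⟨c, hc, h1, h2⟩
    have : c = x := hanti _ _ h2 h1
    exact hc.2 (this ▸ hxi)
  obtain ⟨u, v, hu, hv, hxu, hxv, huv⟩ := isOpen_prod_iff.1 hMc.isOpen_compl x x hxM
  refine ⟨(u ∩ v) ∩ interior N, N, (hu.inter hv).inter isOpen_interior, ⟨⟨hxu, hxv⟩, hxi⟩, hN, ?_⟩
  intro z hz w hw y hzy hyw
  by_contra hy
  rcases (hT (show (z, y) ∈ {p : E × E | p.1 ≤ p.2} from hzy)).2 with (h | h) | ⟨d, hd, h3, h4⟩
  · exact h hz.2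
  · exact hy h
  · exact huv (mk_mem_prod hz.1.1 hw.1.2) ⟨d, hd, h3, le_trans h4 hyw⟩

lemma countable_family [SecondCountableTopology E]
    (ho : ∀ x y : E, ¬ x ≤ y → ∃ f ∈ Phi E, f y < f x)
    (ht : ∀ (x : E) (U : Set E), IsOpen U → x ∈ U → ∃ f ∈ Phi E, ∃ g ∈ Phi E,
      1/2 < f x ∧ g x < 1/2 ∧ ∀ y, 1/2 < f y → g y < 1/2 → y ∈ U) :
    ∃ F : ℕ → E → ℝ, (∀ n, F n ∈ Phi E) ∧ (∀ x y : E, ¬ x ≤ y → ∃ n, F n y < F n x) ∧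
      (∀ (x : E) (U : Set E), IsOpen U → x ∈ U → ∃ m n,
        1/2 < F m x ∧ F n x < 1/2 ∧ ∀ y, 1/2 < F m y → F n y < 1/2 → y ∈ U) := by
  obtain ⟨T, hTP, hTc, hT⟩ := TopologicalSpace.isOpen_biUnion_countable (Phi E)
    (fun f => {q : E × E | f q.2 < f q.1})
    (fun f hf => isOpen_lt (hf.1.comp continuous_snd) (hf.1.comp continuous_fst))
  have hb := TopologicalSpace.isBasis_countableBasis E
  have key : ∀ O : Set E, ∃ S : Set ((E → ℝ) × (E → ℝ)), S.Countable ∧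
      S ⊆ (Phi E ×ˢ Phi E) ∩ {q | ∀ y, 1/2 < q.1 y → q.2 y < 1/2 → y ∈ O} ∧
      (IsOpen O → ∀ x ∈ O, ∃ q ∈ S, 1/2 < q.1 x ∧ q.2 x < 1/2) := by
    intro O
    obtain ⟨S, h1, h2, h3⟩ := TopologicalSpace.isOpen_biUnion_countable
      ((Phi E ×ˢ Phi E) ∩ {q | ∀ y, 1/2 < q.1 y → q.2 y < 1/2 → y ∈ O})
      (fun q => {x : E | 1/2 < q.1 x} ∩ {x | q.2 x < 1/2})
      (fun q hq => (isOpen_lt continuous_const hq.1.1.1).inter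
        (isOpen_lt hq.1.2.1 continuous_const))
    refine ⟨S, h2, h1, fun hO x hx => ?_⟩
    obtain ⟨f, hf, g, hg, h4, h5, h6⟩ := ht x O hO hx
    have : x ∈ ⋃ q ∈ S, {x : E | 1/2 < q.1 x} ∩ {x | q.2 x < 1/2} := by
      rw [h3]
      exact mem_iUnion₂.2 ⟨(f, g), ⟨⟨hf, hg⟩, h6⟩, h4, h5⟩
    obtain ⟨q, hq, h⟩ := mem_iUnion₂.1 this
    exact ⟨q, hq, h⟩
  choose S hSc hSs hS using key
  set W : Set (E → ℝ) := {fun _ => 0} ∪ T ∪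
    ⋃ O ∈ TopologicalSpace.countableBasis E, (Prod.fst '' S O ∪ Prod.snd '' S O) with hW
  have hWc : W.Countable := ((countable_singleton _).union hTc).union
    ((TopologicalSpace.countable_countableBasis E).biUnion fun O _ =>
      ((hSc O).image _).union ((hSc O).image _))
  obtain ⟨F, hF⟩ := hWc.exists_eq_range ⟨_, Or.inl (Or.inl rfl)⟩
  have hWF : ∀ f ∈ W, ∃ n, F n = f := fun f hf => by rw [hF] at hf; exact hf
  refine ⟨F, ?_, ?_, ?_⟩
  · intro n
    have : F n ∈ W := by rw [hF]; exact mem_range_self n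
    rcases this with (h | h) | h
    · rw [mem_singleton_iff] at h
      rw [h]
      exact ⟨continuous_const, monotone_const, fun x => ⟨le_refl _, zero_le_one⟩⟩
    · exact hTP h
    · obtain ⟨O, hO, ⟨q, hq, h⟩ | ⟨q, hq, h⟩⟩ := mem_iUnion₂.1 h
      · rw [← h]; exact (hSs O hq).1.1
      · rw [← h]; exact (hSs O hq).1.2
  · intro x y hxy
    obtain ⟨f, hf, h⟩ := ho x y hxy
    have : (x, y) ∈ ⋃ f ∈ T, {q : E × E | f q.2 < f q.1} := by
      rw [hT]; exact mem_iUnion₂.2 ⟨f, hf, h⟩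
    obtain ⟨f, hf, h⟩ := mem_iUnion₂.1 this
    obtain ⟨n, rfl⟩ := hWF f (Or.inl (Or.inr hf))
    exact ⟨n, h⟩
  · intro x U hU hx
    obtain ⟨O, hO, hxO, hOU⟩ := hb.exists_subset_of_mem_open hx hU
    obtain ⟨q, hq, h1, h2⟩ := hS O (hb.isOpen hO) x hxO
    obtain ⟨m, hm⟩ := hWF q.1 (Or.inr (mem_iUnion₂.2 ⟨O, hO, Or.inl ⟨q, hq, rfl⟩⟩))
    obtain ⟨n, hn⟩ := hWF q.2 (Or.inr (mem_iUnion₂.2 ⟨O, hO, Or.inr ⟨q, hq, rfl⟩⟩))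
    refine ⟨m, n, ?_, ?_, ?_⟩
    · rw [hm]; exact h1
    · rw [hn]; exact h2
    · intro y hy1 hy2
      rw [hm] at hy1
      rw [hn] at hy2
      exact hOU ((hSs O hq).2 y hy1 hy2)

lemma metric_of_family (hanti : ∀ a b : E, a ≤ b → b ≤ a → a = b) (F : ℕ → E → ℝ)
    (hF : ∀ n, F n ∈ Phi E) (ho : ∀ x y : E, ¬ x ≤ y → ∃ n, F n y < F n x)
    (ht : ∀ (x : E) (U : Set E), IsOpen U → x ∈ U → ∃ m n,
        1/2 < F m x ∧ F n x < 1/2 ∧ ∀ y, 1/2 < F m y → F n y < 1/2 → y ∈ U) :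
    ∃ p : E → E → ℝ,
      (∀ x y : E, 0 ≤ p x y) ∧
      (∀ x : E, p x x = 0) ∧
      (∀ x y z : E, p x z ≤ p x y + p y z) ∧
      (∀ S : Set E, IsOpen S ↔
        ∀ x ∈ S, ∃ ε : ℝ, 0 < ε ∧ {y : E | max (p x y) (p y x) < ε} ⊆ S) ∧
      (∀ x y : E, x ≤ y ↔ p x y = 0) ∧
      (∀ x y : E, p x y = 0 → p y x = 0 → x = y) := by
  let t : ℕ → E → E → ℝ := fun n x y => (1/2 : ℝ)^n * max (F n x - F n y) 0
  have t0 : ∀ n x y, 0 ≤ t n x y := fun n x y => by positivity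
  have t1 : ∀ n x y, t n x y ≤ (1/2 : ℝ)^n := fun n x y => by
    refine mul_le_of_le_one_right (by positivity) (max_le ?_ zero_le_one)
    have := (hF n).2.2 x
    have := (hF n).2.2 y
    linarith
  have hs : ∀ x y, Summable fun n => t n x y := fun x y =>
    Summable.of_nonneg_of_le (fun n => t0 n x y) (fun n => t1 n x y) summable_geometric_two
  have htc : ∀ n, Continuous fun q : E × E => t n q.1 q.2 := fun n => by
    have := (hF n).1
    fun_prop
  let p : E → E → ℝ := fun x y => ∑' n, t n x y
  have hpc : Continuous fun q : E × E => p q.1 q.2 :=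
    continuous_tsum htc summable_geometric_two fun n q => by
      rw [Real.norm_of_nonneg (t0 _ _ _)]; exact t1 _ _ _
  have htp : ∀ n x y, t n x y ≤ p x y := fun n x y =>
    (hs x y).le_tsum n fun m _ => t0 m x y
  have hp0 : ∀ x y, 0 ≤ p x y := fun x y => tsum_nonneg fun n => t0 n x y
  have hle : ∀ x y : E, x ≤ y → p x y = 0 := by
    intro x y hxy
    have : ∀ n, t n x y = 0 := fun n => by
      have := (hF n).2.1 hxy
      simp only [t]
      rw [max_eq_right (by linarith), mul_zero]
    simp [p, this]
  have hge : ∀ x y : E, p x y = 0 → x ≤ y := by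
    intro x y hxy
    by_contra h
    obtain ⟨n, hn⟩ := ho x y h
    have h1 := htp n x y
    have h2 : 0 < t n x y := by
      have : 0 < max (F n x - F n y) 0 := lt_max_of_lt_left (by linarith)
      positivity
    linarith
  have hsm : ∀ n x y δ, p x y < (1/2 : ℝ)^n * δ → F n x - F n y < δ := by
    intro n x y δ h
    have h1 := (htp n x y).trans_lt h
    have h2 : max (F n x - F n y) 0 < δ := lt_of_mul_lt_mul_left h1 (by positivity)
    exact (le_max_left _ _).trans_lt h2
  refine ⟨p, hp0, fun x => hle x x le_rfl, ?_, ?_, fun x y => ⟨hle x y, hge x y⟩,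
    fun x y h h' => hanti x y (hge x y h) (hge y x h')⟩
  · intro x y z
    simp only [p]
    rw [← (hs x y).tsum_add (hs y z)]
    refine (hs x z).tsum_le_tsum (fun n => ?_) ((hs x y).add (hs y z))
    simp only [t]
    rw [← mul_add]
    refine mul_le_mul_of_nonneg_left (max_le ?_ ?_) (by positivity)
    · have := le_max_left (F n x - F n y) 0
      have := le_max_left (F n y - F n z) 0
      linarith
    · positivity
  · intro S
    constructor
    · intro hS x hx
      obtain ⟨m, n, h1, h2, h3⟩ := ht x S hS hx
      refine ⟨min ((1/2 : ℝ)^m * (F m x - 1/2)) ((1/2 : ℝ)^n * (1/2 - F n x)), ?_, ?_⟩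
      · exact lt_min (mul_pos (by positivity) (by linarith)) (mul_pos (by positivity) (by linarith))
      · intro y hy
        rw [mem_ofPred_eq, max_lt_iff, lt_min_iff, lt_min_iff] at hy
        have h4 := hsm m x y _ hy.1.1
        have h5 := hsm n y x _ hy.2.2
        exact h3 y (by linarith) (by linarith)
    · intro h
      rw [isOpen_iff_mem_nhds]
      intro x hx
      obtain ⟨ε, hε, hsub⟩ := h x hx
      refine Filter.mem_of_superset (IsOpen.mem_nhds ?_ ?_) hsub
      · exact isOpen_lt ((hpc.comp (by fun_prop : Continuous fun y : E => (x, y))).max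
          (hpc.comp (by fun_prop : Continuous fun y : E => (y, x)))) continuous_const
      · simp [hle x x le_rfl, hε]

end

end QPM

/-- A second countable, locally compact closed ordered space which is
k-preserving or compactly generated is quasi-pseudo-metrizable: there is a
quasi-pseudo-metric `p` (in fact an Albert quasi-metric) such that the topology
is induced by the pseudo-metric `max (p x y) (p y x)` and `x ≤ y ↔ p x y = 0`. -/
theorem quasiPseudoMetrizable_of_closedOrdered {E : Type*} [TopologicalSpace E]
    [Preorder E] [SecondCountableTopology E]
    (hG : IsClosed {p : E × E | p.1 ≤ p.2})
    (hanti : ∀ a b : E, a ≤ b → b ≤ a → a = b)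
    (hloc : ∀ x : E, ∃ K : Set E, IsCompact K ∧ K ∈ 𝓝 x)
    (hkc : (∀ K : Set E, IsCompact K → IsCompact (decHull K ∩ incHull K)) ∨
      (∃ R : Set (E × E), R ⊆ {p : E × E | p.1 ≤ p.2} ∧
        (∀ K : Set E, IsCompact K → IsCompact (closure (relImage R K))) ∧
        (∀ T : Set (E × E), IsClosed T → (∀ a : E, (a, a) ∈ T) →
          (∀ a b c : E, (a, b) ∈ T → (b, c) ∈ T → (a, c) ∈ T) → R ⊆ T →
          {p : E × E | p.1 ≤ p.2} ⊆ T))) :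
    ∃ p : E → E → ℝ,
      (∀ x y : E, 0 ≤ p x y) ∧
      (∀ x : E, p x x = 0) ∧
      (∀ x y z : E, p x z ≤ p x y + p y z) ∧
      (∀ S : Set E, IsOpen S ↔
        ∀ x ∈ S, ∃ ε : ℝ, 0 < ε ∧ {y : E | max (p x y) (p y x) < ε} ⊆ S) ∧
      (∀ x y : E, x ≤ y ↔ p x y = 0) ∧
      (∀ x y : E, p x y = 0 → p y x = 0 → x = y) := by
  
  have hdiag : IsClosed (Set.diagonal E) := by
    have : Set.diagonal E = {p : E × E | p.1 ≤ p.2} ∩ {p : E × E | p.2 ≤ p.1} := by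
      ext ⟨a, b⟩
      constructor
      · intro h
        have h' : a = b := h
        subst h'
        exact ⟨le_refl a, le_refl a⟩
      · rintro ⟨h1, h2⟩
        exact hanti a b h1 h2
    rw [this]
    exact hG.inter (hG.preimage continuous_swap)
  have : T2Space E := t2_iff_isClosed_diagonal.2 hdiag
  have : WeaklyLocallyCompactSpace E := ⟨hloc⟩
  have : OrderClosedTopology E := ⟨hG⟩
  let K := CompactExhaustion.choice E
  have sepm := fun (m : ℕ) (A B U : Set E) => QPM.sep hG (fun n => K (m + n))
    (fun n => K.isCompact _) (fun n => K.subset_interior_succ (m + n))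
    (fun x => by
      obtain ⟨n, hn⟩ := K.exists_mem x
      exact ⟨n, K.subset (Nat.le_add_left n m) hn⟩) (A := A) (B := B) (U := U)
  have ury := fun c u : Set E => QPM.urysohn (E := E) (c := c) (u := u)
    (fun A B hA hB hAi hBi hAB => sepm 0 A B ∅ hA hB hAi hBi isOpen_empty hAB (Or.inl rfl))
  have hull : ∀ x : E, ∃ U N : Set E, IsOpen U ∧ x ∈ U ∧ IsCompact N ∧
      ∀ z ∈ U, ∀ w ∈ U, ∀ y, z ≤ y → y ≤ w → y ∈ N := by
    intro x
    rcases hkc with h | ⟨R, h1, h2, h3⟩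
    · obtain ⟨N, hN, hx⟩ := hloc x
      exact ⟨interior N, _, isOpen_interior, mem_interior_iff_mem_nhds.2 hx, h N hN,
        fun z hz w hw y hzy hyw => ⟨⟨w, interior_subset hw, hyw⟩, ⟨z, interior_subset hz, hzy⟩⟩⟩
    · exact QPM.hull_of_gen hG hanti R h1 h2 h3 x
  obtain ⟨F, hF, ho, ht⟩ := QPM.countable_family (E := E)
    (by
      intro x y hxy
      obtain ⟨f, hf, h1, h0⟩ := ury (Set.Ici x) (Set.Iic y)ᶜ isClosed_Ici
        isClosed_Iic.isOpen_compl (fun a ha b hab => le_trans ha hab)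
        (fun a ha b hab hb => ha (le_trans hab hb)) (fun a ha hay => hxy (le_trans ha hay))
      refine ⟨f, hf, ?_⟩
      rw [h1 x le_rfl, h0 y (fun h => h le_rfl)]
      exact zero_lt_one)
    (by
      intro x O hO hxO
      obtain ⟨U, N, hU, hxU, hN, hUN⟩ := hull x
      obtain ⟨m, hm⟩ := K.exists_superset_of_isCompact hN
      have hxK : x ∈ K (m + 0) := hm (hUN x hxU x hxU x le_rfl le_rfl)
      obtain ⟨P, Q, hP, hQ, hPi, hQi, hAP, hBQ, hPQ⟩ := sepm m (Set.Ici x) (Set.Iic x) (U ∩ O)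
        isClosed_Ici isClosed_Iic (fun a ha b hab => le_trans ha hab)
        (fun a ha b hab => le_trans hab ha) (hU.inter hO)
        (by
          rintro y ⟨h1, h2⟩
          have : x = y := hanti x y h1 h2
          subst this
          exact ⟨hxU, hxO⟩)
        (Or.inr ⟨fun z hz w hw y h1 h2 => hm (hUN z hz.1 w hw.1 y h1 h2),
          fun y hy => ⟨x, ⟨le_refl x, hxK⟩, hy⟩, fun y hy => ⟨x, ⟨le_refl x, hxK⟩, hy⟩⟩)
      obtain ⟨f, hf, f1, f0⟩ := ury (Set.Ici x) P isClosed_Ici hP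
        (fun a ha b hab => le_trans ha hab) hPi hAP
      obtain ⟨g, hg, g1, g0⟩ := ury Qᶜ (Set.Iic x)ᶜ hQ.isClosed_compl isClosed_Iic.isOpen_compl
        (fun a ha b hab hb => ha (hQi b hb a hab))
        (fun a ha b hab hb => ha (le_trans hab hb)) (Set.compl_subset_compl.2 hBQ)
      refine ⟨f, hf, g, hg, ?_, ?_, ?_⟩
      · rw [f1 x le_rfl]; norm_num
      · rw [g0 x (fun h => h le_rfl)]; norm_num
      · intro y hy1 hy2
        refine (hPQ ⟨?_, ?_⟩).2
        · by_contra h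
          rw [f0 y h] at hy1
          norm_num at hy1
        · by_contra h
          rw [g1 y h] at hy2
          norm_num at hy2)
  exact QPM.metric_of_family hanti F hF ho ht
end

section
/- Let E be a closed preordered space whose topology is second countable and locally compact, which is locally convex, and which is an I-space (for every open set S, both d(S) and i(S) are open). Then E is strictly quasi-pseudo-metrizable: E is convex, i(x) and d(x) are closed for every x, and there exists a quasi-pseudo-metric p : E × E → [0,∞) such that the topology induced by p equals the upper topology 𝒯♯ (the topology whose open sets are the increasing open sets of E) and the topology induced by the conjugate p⁻¹(x,y) = p(y,x) equals the lower topology 𝒯♭ (the topology whose open sets are the decreasing open sets of E). -/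
open Topology

/-- A subset `C` is (order) convex if `C = d(C) ∩ i(C)`. -/
def IsOrdConvex {E : Type*} [Preorder E] (C : Set E) : Prop :=
  decHull C ∩ incHull C = C

theorem isUpperSet_incHull {E : Type*} [Preorder E] (S : Set E) : IsUpperSet (incHull S) := by
  rintro a b hab ⟨x, hx, hxa⟩
  exact ⟨x, hx, hxa.trans hab⟩

theorem subset_incHull {E : Type*} [Preorder E] (S : Set E) : S ⊆ incHull S :=
  fun x hx => ⟨x, hx, le_rfl⟩

theorem incHull_subset {E : Type*} [Preorder E] {S U : Set E} (h : S ⊆ U) (hU : IsUpperSet U) :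
    incHull S ⊆ U := by
  rintro y ⟨x, hx, hxy⟩
  exact hU hxy (h hx)

theorem incHull_eq_iff {E : Type*} [Preorder E] {S : Set E} : incHull S = S ↔ IsUpperSet S :=
  ⟨fun h => h ▸ isUpperSet_incHull S,
    fun h => Set.Subset.antisymm (incHull_subset subset_rfl h) (subset_incHull S)⟩

theorem decHull_eq_iff {E : Type*} [Preorder E] {S : Set E} : decHull S = S ↔ IsLowerSet S := by
  constructor
  · intro h a b hab ha
    rw [← h]
    exact ⟨a, ha, hab⟩
  · intro h
    apply Set.Subset.antisymm
    · rintro y ⟨x, hx, hxy⟩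
      exact h hxy hx
    · exact fun x hx => ⟨x, hx, le_rfl⟩

theorem isClosed_incHull_of_compact {E : Type*} [TopologicalSpace E] [Preorder E]
    (hG : IsClosed {p : E × E | p.1 ≤ p.2}) {K : Set E} (hK : IsCompact K) :
    IsClosed (incHull K) := by
  have : CompactSpace K := isCompact_iff_compactSpace.1 hK
  have h1 : IsClosed {q : K × E | (q.1 : E) ≤ q.2} :=
    hG.preimage (f := fun q : K × E => ((q.1 : E), q.2)) (by fun_prop)
  have h2 := isClosedMap_snd_of_compactSpace _ h1
  convert h2 using 1
  ext y
  constructor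
  · rintro ⟨x, hx, hxy⟩
    exact ⟨(⟨x, hx⟩, y), hxy, rfl⟩
  · rintro ⟨⟨x, z⟩, hxz, rfl⟩
    exact ⟨x, x.2, hxz⟩

theorem isUpperSet_closure_of_ISpace {E : Type*} [TopologicalSpace E] [Preorder E]
    (hI : ∀ S : Set E, IsOpen S → IsOpen (decHull S) ∧ IsOpen (incHull S))
    {V : Set E} (hV : IsUpperSet V) : IsUpperSet (closure V) := by
  intro y z hyz hy
  rw [mem_closure_iff] at hy ⊢
  intro N hN hz
  obtain ⟨w, ⟨n, hn, hwn⟩, hwV⟩ := hy (decHull N) (hI N hN).1 ⟨z, hz, hyz⟩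
  exact ⟨n, hn, hV hwn hwV⟩

/-- Compact neighbourhoods inside increasing open sets. -/
theorem exists_compact_nhds_subset {E : Type*} [TopologicalSpace E] [Preorder E]
    (hG : IsClosed {p : E × E | p.1 ≤ p.2})
    (hloc : ∀ x : E, ∃ K : Set E, IsCompact K ∧ K ∈ 𝓝 x)
    {U : Set E} (hU : IsOpen U) (hU' : IsUpperSet U) {x : E} (hx : x ∈ U) :
    ∃ K : Set E, IsCompact K ∧ K ∈ 𝓝 x ∧ K ⊆ U := by
  obtain ⟨K, hK, hKx⟩ := hloc x
  have hKU : IsCompact (K \ U) := hK.diff hU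
  have hopen : IsOpen {p : E × E | p.1 ≤ p.2}ᶜ := hG.isOpen_compl
  have hsub : ({x} : Set E) ×ˢ (K \ U) ⊆ {p : E × E | p.1 ≤ p.2}ᶜ := by
    rintro ⟨a, b⟩ ⟨ha, hb⟩ hab
    rw [Set.mem_singleton_iff] at ha
    simp only at ha
    subst ha
    exact hb.2 (hU' hab hx)
  obtain ⟨A, B, hA, hB, hxA, hKB, hAB⟩ :=
    generalized_tube_lemma isCompact_singleton hKU hopen hsub
  refine ⟨K \ B, hK.diff hB, ?_, ?_⟩
  · filter_upwards [hKx, hA.mem_nhds (hxA rfl)] with a haK haA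
    exact ⟨haK, fun haB => hAB (Set.mk_mem_prod haA haB) (le_refl a)⟩
  · intro a ha
    by_contra h
    exact ha.2 (hKB ⟨ha.1, h⟩)

theorem exists_compact_between_upper {E : Type*} [TopologicalSpace E] [Preorder E]
    (hG : IsClosed {p : E × E | p.1 ≤ p.2})
    (hloc : ∀ x : E, ∃ K : Set E, IsCompact K ∧ K ∈ 𝓝 x)
    {U : Set E} (hU : IsOpen U) (hU' : IsUpperSet U) {K : Set E} (hK : IsCompact K)
    (hKU : K ⊆ U) : ∃ L : Set E, IsCompact L ∧ K ⊆ interior L ∧ L ⊆ U := by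
  choose! L hL hLn hLU using
    fun (x : E) (hx : x ∈ U) => exists_compact_nhds_subset hG hloc hU hU' hx
  obtain ⟨t, ht, hcov⟩ := hK.elim_nhds_subcover (fun x => interior (L x))
    (fun x hx => interior_mem_nhds.2 (hLn x (hKU hx)))
  refine ⟨⋃ x ∈ t, L x, t.isCompact_biUnion fun x hx => hL x (hKU (ht x hx)), ?_, ?_⟩
  · refine hcov.trans (Set.iUnion₂_subset fun x hx => interior_mono ?_)
    exact Set.subset_biUnion_of_mem (u := L) hx
  · exact Set.iUnion₂_subset fun x hx => hLU x (hKU (ht x hx))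

/-- The property used in the Urysohn construction. -/
def UrP {E : Type*} [TopologicalSpace E] [Preorder E] (c u : Set E) : Prop :=
  IsUpperSet c ∧ IsUpperSet u ∧ ∃ K : Set E, IsCompact K ∧ c ⊆ incHull K ∧ K ⊆ u

theorem antitone_approx {E : Type*} [TopologicalSpace E] [Preorder E]
    (n : ℕ) (c : Urysohns.CU (UrP (E := E))) : Antitone (c.approx n) := by
  induction n generalizing c with
  | zero =>
    intro x y hxy
    simp only [Urysohns.CU.approx]
    by_cases hy : y ∈ c.U
    · rw [Set.indicator_of_notMem (by simpa using hy)]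
      exact Set.indicator_nonneg (fun _ _ => zero_le_one) _
    · have hx : x ∉ c.U := fun hx => hy (c.P_C_U.2.1 hxy hx)
      rw [Set.indicator_of_mem (by simpa using hy), Set.indicator_of_mem (by simpa using hx)]
      exact le_rfl
  | succ n ih =>
    intro x y hxy
    simp only [Urysohns.CU.approx]
    exact midpoint_le_midpoint (ih _ hxy) (ih _ hxy)

theorem exists_monotone_urysohn {E : Type*} [TopologicalSpace E] [Preorder E]
    (hG : IsClosed {p : E × E | p.1 ≤ p.2})
    (hloc : ∀ x : E, ∃ K : Set E, IsCompact K ∧ K ∈ 𝓝 x)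
    (hI : ∀ S : Set E, IsOpen S → IsOpen (decHull S) ∧ IsOpen (incHull S))
    {U : Set E} (hU : IsOpen U) (hU' : IsUpperSet U) {K : Set E} (hK : IsCompact K)
    (hKU : K ⊆ U) :
    ∃ f : E → ℝ, Continuous f ∧ Monotone f ∧ (∀ x, f x ∈ Set.Icc (0 : ℝ) 1) ∧
      (∀ x ∈ K, f x = 1) ∧ (∀ x, x ∉ U → f x = 0) := by
  let c : Urysohns.CU (UrP (E := E)) :=
    { C := incHull K
      U := U
      P_C_U := ⟨isUpperSet_incHull K, hU', K, hK, subset_rfl, hKU⟩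
      closed_C := isClosed_incHull_of_compact hG hK
      open_U := hU
      subset := incHull_subset hKU hU'
      hP := by
        rintro c u - ⟨hc, hu, K, hK, hcK, hKu⟩ huo -
        obtain ⟨L, hL, hKL, hLu⟩ := exists_compact_between_upper hG hloc huo hu hK hKu
        have hv : IsUpperSet (incHull (interior L)) := isUpperSet_incHull _
        have hKv : K ⊆ incHull (interior L) := hKL.trans (subset_incHull _)
        have hcl : closure (incHull (interior L)) ⊆ incHull L :=
          closure_minimal
            (incHull_subset (interior_subset.trans (subset_incHull L)) (isUpperSet_incHull L))
            (isClosed_incHull_of_compact hG hL)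
        exact ⟨incHull (interior L), (hI _ isOpen_interior).2,
          hcK.trans (incHull_subset hKv hv), hcl.trans (incHull_subset hLu hu),
          ⟨hc, hv, K, hK, hcK, hKv⟩,
          ⟨isUpperSet_closure_of_ISpace hI hv, hu, L, hL, hcl, hLu⟩⟩ }
  refine ⟨fun x => 1 - c.lim x, continuous_const.sub c.continuous_lim, ?_, ?_, ?_, ?_⟩
  · intro x y hxy
    have : c.lim y ≤ c.lim x :=
      ciSup_mono (c.bddAbove_range_approx x) fun n => antitone_approx n c hxy
    simp only
    linarith
  · intro x
    have := c.lim_mem_Icc x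
    exact ⟨by linarith [this.2], by linarith [this.1]⟩
  · intro x hx
    simp only
    rw [c.lim_of_mem_C x (subset_incHull K hx), sub_zero]
  · intro x hx
    simp only
    rw [c.lim_of_notMem_U x hx, sub_self]

theorem exists_countable_family {E : Type*} [TopologicalSpace E] [Preorder E]
    [SecondCountableTopology E]
    (hG : IsClosed {p : E × E | p.1 ≤ p.2})
    (hloc : ∀ x : E, ∃ K : Set E, IsCompact K ∧ K ∈ 𝓝 x)
    (hI : ∀ S : Set E, IsOpen S → IsOpen (decHull S) ∧ IsOpen (incHull S)) :
    ∃ f : (TopologicalSpace.countableBasis E × TopologicalSpace.countableBasis E) → E → ℝ,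
      (∀ i, Continuous (f i)) ∧ (∀ i, Monotone (f i)) ∧ (∀ i x, f i x ∈ Set.Icc (0 : ℝ) 1) ∧
      ∀ U : Set E, IsOpen U → IsUpperSet U → ∀ x ∈ U, ∃ i, f i x = 1 ∧ ∀ y, y ∉ U → f i y = 0 := by
  have key : ∀ i : TopologicalSpace.countableBasis E × TopologicalSpace.countableBasis E,
      ∃ f : E → ℝ, Continuous f ∧ Monotone f ∧ (∀ x, f x ∈ Set.Icc (0 : ℝ) 1) ∧
        ((∃ K : Set E, IsCompact K ∧ (i.1 : Set E) ⊆ K ∧ K ⊆ incHull (i.2 : Set E)) →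
          (∀ x ∈ (i.1 : Set E), f x = 1) ∧ ∀ x, x ∉ incHull (i.2 : Set E) → f x = 0) := by
    intro i
    by_cases h : ∃ K : Set E, IsCompact K ∧ (i.1 : Set E) ⊆ K ∧ K ⊆ incHull (i.2 : Set E)
    · obtain ⟨K, hK, h1, h2⟩ := h
      obtain ⟨f, hf, hm, hb, hf1, hf0⟩ := exists_monotone_urysohn hG hloc hI
        (hI _ (TopologicalSpace.isOpen_of_mem_countableBasis i.2.2)).2 (isUpperSet_incHull _) hK h2
      exact ⟨f, hf, hm, hb, fun _ => ⟨fun x hx => hf1 x (h1 hx), hf0⟩⟩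
    · exact ⟨fun _ => 0, continuous_const, monotone_const, fun _ => by simp, fun h' => (h h').elim⟩
  choose f hf hm hb hs using key
  refine ⟨f, hf, hm, hb, ?_⟩
  intro U hU hU' x hx
  have hbasis := TopologicalSpace.isBasis_countableBasis E
  obtain ⟨B, hB, hxB, hBU⟩ := hbasis.exists_subset_of_mem_open hx hU
  have hBo : IsOpen (incHull B) := (hI _ (TopologicalSpace.isOpen_of_mem_countableBasis hB)).2
  obtain ⟨K, hK, hKx, hKB⟩ := exists_compact_nhds_subset hG hloc hBo (isUpperSet_incHull B)
    (subset_incHull B hxB)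
  obtain ⟨A, hA, hxA, hAK⟩ := hbasis.exists_subset_of_mem_open (mem_interior_iff_mem_nhds.2 hKx)
    isOpen_interior
  obtain ⟨h1, h0⟩ := hs (⟨A, hA⟩, ⟨B, hB⟩) ⟨K, hK, hAK.trans interior_subset, hKB⟩
  exact ⟨_, h1 x hxA, fun y hy => h0 y fun hyB => hy (incHull_subset hBU hU' hyB)⟩

theorem exists_countable_family_lower {E : Type*} [TopologicalSpace E] [Preorder E]
    [SecondCountableTopology E]
    (hG : IsClosed {p : E × E | p.1 ≤ p.2})
    (hloc : ∀ x : E, ∃ K : Set E, IsCompact K ∧ K ∈ 𝓝 x)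
    (hI : ∀ S : Set E, IsOpen S → IsOpen (decHull S) ∧ IsOpen (incHull S)) :
    ∃ f : (TopologicalSpace.countableBasis E × TopologicalSpace.countableBasis E) → E → ℝ,
      (∀ i, Continuous (f i)) ∧ (∀ i, Antitone (f i)) ∧ (∀ i x, f i x ∈ Set.Icc (0 : ℝ) 1) ∧
      ∀ U : Set E, IsOpen U → IsLowerSet U → ∀ x ∈ U, ∃ i, f i x = 1 ∧ ∀ y, y ∉ U → f i y = 0 := by
  let P' : Preorder E :=
    { le := fun a b => b ≤ a
      le_refl := fun a => le_refl a
      le_trans := fun a b c h1 h2 => le_trans h2 h1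
      lt := fun a b => b < a
      lt_iff_le_not_ge := fun a b => lt_iff_le_not_ge (a := b) (b := a) }
  obtain ⟨f, hf, hm, hb, hs⟩ := @exists_countable_family E _ P' _
    (hG.preimage continuous_swap) hloc (fun S hS => ⟨(hI S hS).2, (hI S hS).1⟩)
  refine ⟨f, hf, fun i a b hab => hm i hab, hb, fun U hU hU' x hx => hs U hU ?_ x hx⟩
  exact fun a b hab ha => hU' hab ha

/-- Every second countable, locally compact, locally convex closed preordered
`I`-space is strictly quasi-pseudo-metrizable: it is convex and semiclosed
preordered, and there is a quasi-pseudo-metric `p` inducing the upper topology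
(increasing open sets), whose conjugate induces the lower topology (decreasing
open sets). -/
theorem strictly_quasiPseudoMetrizable_of_ISpace {E : Type*} [TopologicalSpace E]
    [Preorder E] [SecondCountableTopology E]
    (hG : IsClosed {p : E × E | p.1 ≤ p.2})
    (hloc : ∀ x : E, ∃ K : Set E, IsCompact K ∧ K ∈ 𝓝 x)
    (hlconv : ∀ x : E, ∀ O ∈ 𝓝 x, ∃ C ∈ 𝓝 x, IsOrdConvex C ∧ C ⊆ O)
    (hI : ∀ S : Set E, IsOpen S → IsOpen (decHull S) ∧ IsOpen (incHull S)) :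
    (∀ x : E, ∀ O : Set E, IsOpen O → x ∈ O →
      ∃ U V : Set E, IsOpen U ∧ decHull U = U ∧ IsOpen V ∧ incHull V = V ∧
        x ∈ U ∩ V ∧ U ∩ V ⊆ O) ∧
    (∀ x : E, IsClosed (incHull {x}) ∧ IsClosed (decHull {x})) ∧
    ∃ p : E → E → ℝ,
      (∀ x y : E, 0 ≤ p x y) ∧
      (∀ x : E, p x x = 0) ∧
      (∀ x y z : E, p x z ≤ p x y + p y z) ∧
      (∀ S : Set E, (∀ x ∈ S, ∃ ε : ℝ, 0 < ε ∧ {y : E | p x y < ε} ⊆ S) ↔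
        (IsOpen S ∧ incHull S = S)) ∧
      (∀ S : Set E, (∀ x ∈ S, ∃ ε : ℝ, 0 < ε ∧ {y : E | p y x < ε} ⊆ S) ↔
        (IsOpen S ∧ decHull S = S)) := by
  refine ⟨?_, ?_, ?_⟩
  · intro x O hO hx
    obtain ⟨C, hC, hconv, hCO⟩ := hlconv x O (hO.mem_nhds hx)
    have hxC : x ∈ interior C := mem_interior_iff_mem_nhds.2 hC
    refine ⟨decHull (interior C), incHull (interior C), (hI _ isOpen_interior).1, ?_,
      (hI _ isOpen_interior).2, incHull_eq_iff.2 (isUpperSet_incHull _),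
      ⟨⟨x, hxC, le_rfl⟩, ⟨x, hxC, le_rfl⟩⟩, ?_⟩
    · rw [decHull_eq_iff]
      rintro a b hab ⟨z, hz, haz⟩
      exact ⟨z, hz, hab.trans haz⟩
    · rintro y ⟨⟨a, ha, hya⟩, ⟨b, hb, hby⟩⟩
      apply hCO
      rw [← hconv]
      exact ⟨⟨a, interior_subset ha, hya⟩, ⟨b, interior_subset hb, hby⟩⟩
  · intro x
    refine ⟨isClosed_incHull_of_compact hG isCompact_singleton, ?_⟩
    have : IsClosed {y : E | y ≤ x} :=
      hG.preimage (f := fun y : E => (y, x)) (by fun_prop)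
    convert this using 1
    ext y
    simp [decHull]
  · obtain ⟨f, hf, hfm, hfb, hfs⟩ := exists_countable_family hG hloc hI
    obtain ⟨g, hg, hgm, hgb, hgs⟩ := exists_countable_family_lower hG hloc hI
    let J := TopologicalSpace.countableBasis E × TopologicalSpace.countableBasis E
    -- the combined family of continuous monotone functions
    obtain ⟨F, hF, hFm, hFb, hFf, hFg⟩ : ∃ F : J ⊕ J → E → ℝ, (∀ i, Continuous (F i)) ∧
        (∀ i, Monotone (F i)) ∧ (∀ i x, F i x ∈ Set.Icc (0 : ℝ) 1) ∧
        (∀ i x, F (Sum.inl i) x = f i x) ∧ (∀ i x, F (Sum.inr i) x = 1 - g i x) := by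
      refine ⟨Sum.elim f fun i x => 1 - g i x, ?_, ?_, ?_, fun _ _ => rfl, fun _ _ => rfl⟩
      · rintro (i | i)
        · exact hf i
        · exact continuous_const.sub (hg i)
      · rintro (i | i)
        · exact hfm i
        · intro a b hab
          have := hgm i hab
          simp only [Sum.elim_inr]
          linarith
      · rintro (i | i) x
        · exact hfb i x
        · have := hgb i x
          exact ⟨by simpa using this.2, by simpa using this.1⟩
    let w : J ⊕ J → ℝ := fun i => (1 / 2 : ℝ) ^ Encodable.encode i
    have hw : ∀ i, 0 < w i := fun i => by positivity
    have hws : Summable w := summable_geometric_two_encode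
    let T : J ⊕ J → E → E → ℝ := fun i x y => w i * max (F i x - F i y) 0
    have hT0 : ∀ i x y, 0 ≤ T i x y := fun i x y =>
      mul_nonneg (hw i).le (le_max_right _ _)
    have hTw : ∀ i x y, T i x y ≤ w i := fun i x y => by
      have h1 := hFb i x
      have h2 := hFb i y
      have : max (F i x - F i y) 0 ≤ 1 := max_le (by linarith [h1.2, h2.1]) zero_le_one
      exact mul_le_of_le_one_right (hw i).le this
    have hTs : ∀ x y, Summable fun i => T i x y := fun x y =>
      Summable.of_nonneg_of_le (fun i => hT0 i x y) (fun i => hTw i x y) hws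
    have hTle : ∀ i x y, T i x y ≤ ∑' j, T j x y := fun i x y =>
      (hTs x y).le_tsum i fun j _ => hT0 j x y
    have hmono : ∀ x y, x ≤ y → ∑' i, T i x y = 0 := by
      intro x y hxy
      have : ∀ i, T i x y = 0 := fun i => by
        have := hFm i hxy
        simp only [T]
        rw [max_eq_right (by linarith), mul_zero]
      simp [this]
    have hcont1 : ∀ x, Continuous fun y => ∑' i, T i x y := fun x =>
      continuous_tsum (fun i => by have := hF i; fun_prop) hws fun i y => by
        rw [Real.norm_of_nonneg (hT0 i x y)]
        exact hTw i x y
    have hcont2 : ∀ x, Continuous fun y => ∑' i, T i y x := fun x =>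
      continuous_tsum (fun i => by have := hF i; fun_prop) hws fun i y => by
        rw [Real.norm_of_nonneg (hT0 i y x)]
        exact hTw i y x
    refine ⟨fun x y => ∑' i, T i x y, fun x y => tsum_nonneg fun i => hT0 i x y,
      fun x => hmono x x le_rfl, ?_, ?_, ?_⟩
    · intro x y z
      simp only
      rw [← (hTs x y).tsum_add (hTs y z)]
      refine (hTs x z).tsum_le_tsum (fun i => ?_) ((hTs x y).add (hTs y z))
      simp only [T]
      rw [← mul_add]
      refine mul_le_mul_of_nonneg_left (max_le ?_ ?_) (hw i).le
      · have h1 := le_max_left (F i x - F i y) 0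
        have h2 := le_max_left (F i y - F i z) 0
        linarith
      · exact add_nonneg (le_max_right _ _) (le_max_right _ _)
    · intro S
      rw [incHull_eq_iff]
      constructor
      · intro h
        refine ⟨isOpen_iff_mem_nhds.2 fun x hx => ?_, fun x y hxy hx => ?_⟩
        · obtain ⟨ε, hε, hsub⟩ := h x hx
          refine Filter.mem_of_superset (IsOpen.mem_nhds
            (isOpen_lt (hcont1 x) continuous_const) ?_) hsub
          simpa [hmono x x le_rfl] using hε
        · obtain ⟨ε, hε, hsub⟩ := h x hx
          apply hsub
          simpa [hmono x y hxy] using hε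
      · rintro ⟨hSo, hSu⟩ x hx
        obtain ⟨i, hi1, hi0⟩ := hfs S hSo hSu x hx
        refine ⟨w (Sum.inl i), hw _, fun y hy => ?_⟩
        by_contra hyS
        have h1 : T (Sum.inl i) x y < w (Sum.inl i) := (hTle _ x y).trans_lt hy
        have h2 : T (Sum.inl i) x y = w (Sum.inl i) := by
          simp [T, hFf, hi1, hi0 y hyS]
        exact h1.ne h2
    · intro S
      rw [decHull_eq_iff]
      constructor
      · intro h
        refine ⟨isOpen_iff_mem_nhds.2 fun x hx => ?_, fun x y hxy hx => ?_⟩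
        · obtain ⟨ε, hε, hsub⟩ := h x hx
          refine Filter.mem_of_superset (IsOpen.mem_nhds
            (isOpen_lt (hcont2 x) continuous_const) ?_) hsub
          simpa [hmono x x le_rfl] using hε
        · obtain ⟨ε, hε, hsub⟩ := h x hx
          apply hsub
          simpa [hmono y x hxy] using hε
      · rintro ⟨hSo, hSu⟩ x hx
        obtain ⟨i, hi1, hi0⟩ := hgs S hSo hSu x hx
        refine ⟨w (Sum.inr i), hw _, fun y hy => ?_⟩
        by_contra hyS
        have h1 : T (Sum.inr i) y x < w (Sum.inr i) := (hTle _ y x).trans_lt hy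
        have h2 : T (Sum.inr i) y x = w (Sum.inr i) := by
          simp [T, hFg, hi1, hi0 y hyS]
        exact h1.ne h2
end
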